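/- arXiv:1402.3969 — 2 statements merged into one kernel-verified Lean document; each statement's English description precedes it below -/
import Mathlib

section
/- If A ⊆ {subsets of [m] of size ≤ r} and B ⊆ {subsets of [n] of size ≤ s} are cross-intersecting families (every member of A intersects every member of B), where 1 ≤ r ≤ m and 1 ≤ s ≤ n, then |A|·|B| ≤ (∑_{i=0}^{r} C(m-1, i-1)) · (∑_{j=0}^{s} C(n-1, j-1)). -/
open Finset

/-- Every member of `𝒜` meets every member of `ℬ`. -/
def CrossIntersecting (𝒜 ℬ : Finset (Finset ℕ)) : Prop :=
  ∀ A ∈ 𝒜, ∀ B ∈ ℬ, (A ∩ B).Nonempty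

/-- Every member of `𝒜` is a subset of `{1, …, n}` of size at most `r`. -/
def BoundedFamily (n r : ℕ) (𝒜 : Finset (Finset ℕ)) : Prop :=
  ∀ A ∈ 𝒜, A ⊆ Icc 1 n ∧ #A ≤ r

/-- The number of subsets of size less than `s` of an `n`-element set, which is also the number of
subsets of size at most `s` of an `(n + 1)`-element set that contain a given element. -/
def starCard (n s : ℕ) : ℕ := ∑ k ∈ range s, n.choose k

lemma starCard_succ_succ (n s : ℕ) :
    starCard (n + 1) (s + 1) = starCard n (s + 1) + starCard n s := by
  unfold starCard
  rw [sum_range_succ', sum_range_succ' (fun k ↦ n.choose k)]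
  simp only [Nat.choose_succ_succ, sum_add_distrib, Nat.choose_zero_right]
  ring

lemma starCard_succ_pos (n s : ℕ) : 0 < starCard n (s + 1) := by
  unfold starCard
  rw [sum_range_succ']
  simp

lemma starCard_succ_of_le {n s : ℕ} (h : n ≤ s) : starCard n (s + 1) = 2 ^ n := by
  unfold starCard
  rw [← Nat.sum_range_choose]
  symm
  apply sum_subset
  · intro x
    simp only [mem_range]
    omega
  · intro x _ hx
    apply Nat.choose_eq_zero_of_lt
    simp only [mem_range] at hx
    omega

lemma lt_of_starCard_succ_eq {n s : ℕ} (h : starCard n (s + 1) = starCard n s) : n < s := by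
  unfold starCard at h
  rw [sum_range_succ] at h
  exact Nat.choose_eq_zero_iff.1 (by omega)

namespace CrossIntersecting

variable {𝒜 ℬ : Finset (Finset ℕ)}

lemma symm (h : CrossIntersecting 𝒜 ℬ) : CrossIntersecting ℬ 𝒜 := fun B hB A hA ↦ by
  rw [inter_comm]
  exact h A hA B hB

lemma card_mul_card_eq_zero (h : CrossIntersecting 𝒜 ℬ) {n : ℕ} (hℬ : BoundedFamily n 0 ℬ) :
    #𝒜 * #ℬ = 0 := by
  by_contra hne
  obtain ⟨h𝒜₀, hℬ₀⟩ := Nat.mul_ne_zero_iff.1 hne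
  obtain ⟨A, hA⟩ := card_ne_zero.1 h𝒜₀
  obtain ⟨B, hB⟩ := card_ne_zero.1 hℬ₀
  have hB₀ : B = ∅ := card_eq_zero.1 (Nat.le_zero.1 (hℬ B hB).2)
  simpa [hB₀] using h A hA B hB

end CrossIntersecting

namespace BoundedFamily

variable {𝒜 : Finset (Finset ℕ)} {n r : ℕ}

lemma nonMemberSubfamily (h : BoundedFamily (n + 1) r 𝒜) :
    BoundedFamily n r (𝒜.nonMemberSubfamily (n + 1)) := by
  intro A hA
  rw [mem_nonMemberSubfamily] at hA
  refine ⟨fun x hx ↦ ?_, (h A hA.1).2⟩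
  have hx₁ := mem_Icc.1 ((h A hA.1).1 hx)
  have : x ≠ n + 1 := fun e ↦ hA.2 (e ▸ hx)
  exact mem_Icc.2 (by omega)

lemma memberSubfamily (h : BoundedFamily (n + 1) (r + 1) 𝒜) :
    BoundedFamily n r (𝒜.memberSubfamily (n + 1)) := by
  intro A hA
  rw [mem_memberSubfamily] at hA
  obtain ⟨h₁, h₂⟩ := h _ hA.1
  rw [card_insert_of_notMem hA.2] at h₂
  refine ⟨fun x hx ↦ ?_, by omega⟩
  have hx₁ := mem_Icc.1 (h₁ (mem_insert_of_mem hx))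
  have : x ≠ n + 1 := fun e ↦ hA.2 (e ▸ hx)
  exact mem_Icc.2 (by omega)

lemma mono_subset {ℬ : Finset (Finset ℕ)} (h : BoundedFamily n r 𝒜) (hs : ℬ ⊆ 𝒜) :
    BoundedFamily n r ℬ := fun A hA ↦ h A (hs hA)

lemma mono_right {r' : ℕ} (h : BoundedFamily n r 𝒜) (hr : r ≤ r') : BoundedFamily n r' 𝒜 :=
  fun A hA ↦ ⟨(h A hA).1, (h A hA).2.trans hr⟩

lemma union {ℬ : Finset (Finset ℕ)} (h𝒜 : BoundedFamily n r 𝒜) (hℬ : BoundedFamily n r ℬ) :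
    BoundedFamily n r (𝒜 ∪ ℬ) := fun A hA ↦ (mem_union.1 hA).elim (h𝒜 A) (hℬ A)

lemma injOn_compl (h : BoundedFamily n r 𝒜) : Set.InjOn (Icc 1 n \ ·) (𝒜 : Set (Finset ℕ)) := by
  intro A hA A' hA' he
  rw [← Finset.sdiff_sdiff_eq_self (h A hA).1, ← Finset.sdiff_sdiff_eq_self (h A' hA').1]
  exact congrArg (Icc 1 n \ ·) he

end BoundedFamily

/-- The shift replacing the element `t` by `i` in members of a family. -/
abbrev shift (i t : ℕ) (𝒜 : Finset (Finset ℕ)) : Finset (Finset ℕ) :=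
  UV.compression {i} {t} 𝒜

lemma compress_singleton (i t : ℕ) (A : Finset ℕ) :
    UV.compress {i} {t} A = if i ∉ A ∧ t ∈ A then (insert i A) \ {t} else A := by
  simp [UV.compress]

/-- A member of the shifted family is either an original member whose shift is present as well,
or the shift of an original member. -/
lemma mem_shift {i t : ℕ} {𝒜 : Finset (Finset ℕ)} {A : Finset ℕ} (h : A ∈ shift i t 𝒜) :
    (A ∈ 𝒜 ∧ (i ∉ A → t ∈ A → (insert i A) \ {t} ∈ 𝒜)) ∨
      A ∉ 𝒜 ∧ ∃ A' ∈ 𝒜, i ∉ A' ∧ t ∈ A' ∧ A = (insert i A') \ {t} := by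
  rw [UV.mem_compression] at h
  rcases h with ⟨h₁, h₂⟩ | ⟨h₁, A', h₂, h₃⟩
  · left
    refine ⟨h₁, fun hi ht ↦ ?_⟩
    rwa [compress_singleton, if_pos ⟨hi, ht⟩] at h₂
  · right
    rw [compress_singleton] at h₃
    split_ifs at h₃ with hc
    · exact ⟨h₁, A', h₂, hc.1, hc.2, h₃.symm⟩
    · exact absurd (h₃ ▸ h₂) h₁

lemma BoundedFamily.shift {n r i t : ℕ} {𝒜 : Finset (Finset ℕ)} (h : BoundedFamily n r 𝒜)
    (hi : i ∈ Icc 1 n) : BoundedFamily n r (shift i t 𝒜) := by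
  intro A hA
  rcases mem_shift hA with ⟨h₁, -⟩ | ⟨-, A', hA', hiA, htA, rfl⟩
  · exact h A h₁
  · obtain ⟨h₁, h₂⟩ := h A' hA'
    refine ⟨sdiff_subset.trans (insert_subset hi h₁), ?_⟩
    rw [card_sdiff_of_subset (by simp [htA]), card_insert_of_notMem hiA]
    simpa using h₂

lemma inter_nonempty_of_shift {i t : ℕ} {ℬ : Finset (Finset ℕ)} {A B : Finset ℕ}
    (hi : i ∉ A) (hA : ∀ B ∈ ℬ, (A ∩ B).Nonempty) (hB : B ∈ ℬ)
    (hB' : i ∉ B → t ∈ B → (insert i B) \ {t} ∈ ℬ) :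
    (((insert i A) \ {t}) ∩ B).Nonempty := by
  by_cases hit : i = t
  · subst hit
    obtain ⟨x, hx⟩ := hA B hB
    refine ⟨x, ?_⟩
    grind
  by_cases hiB : i ∈ B
  · exact ⟨i, by grind⟩
  by_cases htB : t ∈ B
  · obtain ⟨x, hx⟩ := hA _ (hB' hiB htB)
    exact ⟨x, by grind⟩
  · obtain ⟨x, hx⟩ := hA B hB
    exact ⟨x, by grind⟩

lemma CrossIntersecting.shift {i t : ℕ} {𝒜 ℬ : Finset (Finset ℕ)} (h : CrossIntersecting 𝒜 ℬ) :
    CrossIntersecting (shift i t 𝒜) (shift i t ℬ) := by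
  intro A hA B hB
  rcases mem_shift hA with ⟨hA₁, hA₂⟩ | ⟨-, A', hA', hiA, htA, rfl⟩ <;>
    rcases mem_shift hB with ⟨hB₁, hB₂⟩ | ⟨-, B', hB', hiB, htB, rfl⟩
  · exact h A hA₁ B hB₁
  · rw [inter_comm]
    exact inter_nonempty_of_shift hiB (h.symm B' hB') hA₁ hA₂
  · exact inter_nonempty_of_shift hiA (h A' hA') hB₁ hB₂
  · exact ⟨i, by grind⟩

lemma filter_shift_subset {i t : ℕ} {𝒜 : Finset (Finset ℕ)} :
    {A ∈ shift i t 𝒜 | t ∈ A} ⊆ {A ∈ 𝒜 | t ∈ A} := by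
  intro A hA
  rw [mem_filter] at hA ⊢
  rcases mem_shift hA.1 with ⟨h₁, -⟩ | ⟨-, A', -, -, -, rfl⟩
  · exact ⟨h₁, hA.2⟩
  · simp at hA

lemma filter_shift_ssubset {i t : ℕ} {𝒜 : Finset (Finset ℕ)} {A : Finset ℕ} (hA : A ∈ 𝒜)
    (hi : i ∉ A) (ht : t ∈ A) (hA' : (insert i A) \ {t} ∉ 𝒜) :
    {A ∈ shift i t 𝒜 | t ∈ A} ⊂ {A ∈ 𝒜 | t ∈ A} := by
  refine filter_shift_subset.ssubset_of_ne fun he ↦ ?_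
  have h₁ : A ∈ {A ∈ shift i t 𝒜 | t ∈ A} := he ▸ mem_filter.2 ⟨hA, ht⟩
  rcases mem_shift (mem_filter.1 h₁).1 with ⟨-, h₂⟩ | ⟨h₂, -⟩
  · exact hA' (h₂ hi ht)
  · exact h₂ hA

/-- Repeated shifting makes the first family stable under all shifts away from the element `n`. -/
lemma CrossIntersecting.exists_stable {n r s : ℕ} {𝒜 ℬ : Finset (Finset ℕ)}
    (h : CrossIntersecting 𝒜 ℬ) (h𝒜 : BoundedFamily n r 𝒜) (hℬ : BoundedFamily n s ℬ) :
    ∃ 𝒜' ℬ', CrossIntersecting 𝒜' ℬ' ∧ BoundedFamily n r 𝒜' ∧ BoundedFamily n s ℬ' ∧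
      #𝒜' = #𝒜 ∧ #ℬ' = #ℬ ∧
      ∀ A ∈ 𝒜', ∀ i ∈ Icc 1 n, i ∉ A → n ∈ A → (insert i A) \ {n} ∈ 𝒜' := by
  induction hk : #{A ∈ 𝒜 | n ∈ A} using Nat.strong_induction_on generalizing 𝒜 ℬ with
  | _ k ih =>
    by_cases hst : ∀ A ∈ 𝒜, ∀ i ∈ Icc 1 n, i ∉ A → n ∈ A → (insert i A) \ {n} ∈ 𝒜
    · exact ⟨𝒜, ℬ, h, h𝒜, hℬ, rfl, rfl, hst⟩
    push Not at hst
    obtain ⟨A, hA, i, hi, hiA, hnA, hA'⟩ := hst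
    obtain ⟨𝒜', ℬ', h₁, h₂, h₃, h₄, h₅, h₆⟩ :=
      ih _ (hk ▸ card_lt_card (filter_shift_ssubset hA hiA hnA hA')) (h.shift (i := i) (t := n))
        (h𝒜.shift hi) (hℬ.shift hi) rfl
    exact ⟨𝒜', ℬ', h₁, h₂, h₃, h₄.trans (UV.card_compression _ _ _),
      h₅.trans (UV.card_compression _ _ _), h₆⟩

/-- If disjoint members of `𝒜₁` and `ℬ₁` are complementary, then splitting up the complementary
pairs yields four cross-intersecting pairs of families. -/
lemma product_bounds_of_complementary {n r s : ℕ} {f : ℕ → ℕ}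
    {𝒜₀ 𝒜₁ ℬ₀ ℬ₁ 𝒟 ℰ : Finset (Finset ℕ)}
    (ih : ∀ (r s : ℕ) (𝒜 ℬ : Finset (Finset ℕ)), CrossIntersecting 𝒜 ℬ →
      BoundedFamily n r 𝒜 → BoundedFamily n s ℬ → #𝒜 * #ℬ ≤ f r * f s)
    (h𝒜₀ : BoundedFamily n (r + 1) 𝒜₀) (h𝒜₁ : BoundedFamily n r 𝒜₁)
    (hℬ₀ : BoundedFamily n (s + 1) ℬ₀) (hℬ₁ : BoundedFamily n s ℬ₁)
    (h₀₀ : CrossIntersecting 𝒜₀ ℬ₀) (h₀₁ : CrossIntersecting 𝒜₀ ℬ₁)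
    (h₁₀ : CrossIntersecting 𝒜₁ ℬ₀)
    (h₁₁ : ∀ A ∈ 𝒜₁, ∀ B ∈ ℬ₁, ¬ (A ∩ B).Nonempty → B = Icc 1 n \ A)
    (hdisj : Disjoint 𝒟 ℰ) (hunion : 𝒟 ∪ ℰ = {A ∈ 𝒜₁ | Icc 1 n \ A ∈ ℬ₁}) :
    (#𝒜₀ + #ℰ) * (#ℬ₀ + #𝒟) ≤ f (r + 1) * f (s + 1) ∧
    (#𝒜₀ + #ℰ) * (#ℬ₁ - #ℰ) ≤ f (r + 1) * f s ∧
    (#𝒜₁ - #𝒟) * (#ℬ₀ + #𝒟) ≤ f r * f (s + 1) ∧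
    (#𝒜₁ - #𝒟) * (#ℬ₁ - #ℰ) ≤ f r * f s := by
  have hmem : ∀ A, A ∈ 𝒟 ∨ A ∈ ℰ ↔ A ∈ 𝒜₁ ∧ Icc 1 n \ A ∈ ℬ₁ := fun A ↦ by
    rw [← mem_union, hunion, mem_filter]
  have h𝒟ℰ : ∀ A ∈ 𝒟, A ∉ ℰ := fun A hA ↦ disjoint_left.1 hdisj hA
  have h𝒟 : 𝒟 ⊆ 𝒜₁ := fun A hA ↦ ((hmem A).1 (.inl hA)).1
  have hℰ : ℰ ⊆ 𝒜₁ := fun A hA ↦ ((hmem A).1 (.inr hA)).1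
  have h𝒟' : 𝒟.image (Icc 1 n \ ·) ⊆ ℬ₁ := image_subset_iff.2 fun A hA ↦ ((hmem A).1 (.inl hA)).2
  have hℰ' : ℰ.image (Icc 1 n \ ·) ⊆ ℬ₁ := image_subset_iff.2 fun A hA ↦ ((hmem A).1 (.inr hA)).2
  have hcard : ∀ 𝒞 ⊆ 𝒜₁, #(𝒞.image (Icc 1 n \ ·)) = #𝒞 := fun 𝒞 h𝒞 ↦
    card_image_of_injOn (h𝒜₁.injOn_compl.mono h𝒞)
  have hcompl : ∀ A, ¬ (A ∩ (Icc 1 n \ A)).Nonempty := fun A ↦ by simp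
  have hdA : Disjoint 𝒜₀ ℰ := disjoint_left.2 fun A hA hAℰ ↦
    hcompl A (h₀₁ A hA _ ((hmem A).1 (.inr hAℰ)).2)
  have hdB : Disjoint ℬ₀ (𝒟.image (Icc 1 n \ ·)) := disjoint_left.2 fun B hB hB𝒟 ↦ by
    obtain ⟨A, hA, rfl⟩ := mem_image.1 hB𝒟
    exact hcompl A (h₁₀ A (h𝒟 hA) _ hB)
  have cA₀ : #(𝒜₀ ∪ ℰ) = #𝒜₀ + #ℰ := card_union_of_disjoint hdA
  have cA₁ : #(𝒜₁ \ 𝒟) = #𝒜₁ - #𝒟 := card_sdiff_of_subset h𝒟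
  have cB₀ : #(ℬ₀ ∪ 𝒟.image (Icc 1 n \ ·)) = #ℬ₀ + #𝒟 := by
    rw [card_union_of_disjoint hdB, hcard 𝒟 h𝒟]
  have cB₁ : #(ℬ₁ \ ℰ.image (Icc 1 n \ ·)) = #ℬ₁ - #ℰ := by
    rw [card_sdiff_of_subset hℰ', hcard ℰ hℰ]
  have bA₀ : BoundedFamily n (r + 1) (𝒜₀ ∪ ℰ) :=
    h𝒜₀.union ((h𝒜₁.mono_subset hℰ).mono_right (Nat.le_succ r))
  have bA₁ : BoundedFamily n r (𝒜₁ \ 𝒟) := h𝒜₁.mono_subset sdiff_subset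
  have bB₀ : BoundedFamily n (s + 1) (ℬ₀ ∪ 𝒟.image (Icc 1 n \ ·)) :=
    hℬ₀.union ((hℬ₁.mono_subset h𝒟').mono_right (Nat.le_succ s))
  have bB₁ : BoundedFamily n s (ℬ₁ \ ℰ.image (Icc 1 n \ ·)) := hℬ₁.mono_subset sdiff_subset
  rw [← cA₀, ← cA₁, ← cB₀, ← cB₁]
  refine ⟨ih _ _ _ _ ?_ bA₀ bB₀, ih _ _ _ _ ?_ bA₀ bB₁, ih _ _ _ _ ?_ bA₁ bB₀,
    ih _ _ _ _ ?_ bA₁ bB₁⟩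
  · intro A hA B hB
    rcases mem_union.1 hA with hA | hA <;> rcases mem_union.1 hB with hB | hB
    · exact h₀₀ A hA B hB
    · exact h₀₁ A hA B (h𝒟' hB)
    · exact h₁₀ A (hℰ hA) B hB
    · by_contra hne
      have he := h₁₁ A (hℰ hA) B (h𝒟' hB) hne
      obtain ⟨A', hA', rfl⟩ := mem_image.1 hB
      exact h𝒟ℰ A' hA' (h𝒜₁.injOn_compl (h𝒟 hA') (hℰ hA) he ▸ hA)
  · intro A hA B hB
    rw [mem_sdiff] at hB
    rcases mem_union.1 hA with hA | hA
    · exact h₀₁ A hA B hB.1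
    · by_contra hne
      have he := h₁₁ A (hℰ hA) B hB.1 hne
      exact hB.2 (mem_image.2 ⟨A, hA, he.symm⟩)
  · intro A hA B hB
    rw [mem_sdiff] at hA
    rcases mem_union.1 hB with hB | hB
    · exact h₁₀ A hA.1 B hB
    · by_contra hne
      have he := h₁₁ A hA.1 B (h𝒟' hB) hne
      obtain ⟨A', hA', rfl⟩ := mem_image.1 hB
      exact hA.2 (h𝒜₁.injOn_compl (h𝒟 hA') hA.1 he ▸ hA')
  · intro A hA B hB
    rw [mem_sdiff] at hA hB
    by_contra hne
    have he := h₁₁ A hA.1 B hB.1 hne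
    rcases (hmem A).2 ⟨hA.1, he ▸ hB.1⟩ with h | h
    · exact hA.2 h
    · exact hB.2 (mem_image.2 ⟨A, h, he.symm⟩)

/-- Recombining the eight bounds obtained from the two almost equal splittings of an odd number of
complementary pairs. -/
lemma product_le_of_odd_split {u₀ u₁ v₀ v₁ R₀ R₁ S₀ S₁ : ℕ}
    (h₁ : (u₀ + 1) * v₀ ≤ R₀ * S₀) (h₂ : (u₀ + 1) * v₁ ≤ R₀ * S₁)
    (h₃ : (u₁ + 1) * v₀ ≤ R₁ * S₀) (h₄ : (u₁ + 1) * v₁ ≤ R₁ * S₁)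
    (h₅ : u₀ * (v₀ + 1) ≤ R₀ * S₀) (h₆ : u₀ * (v₁ + 1) ≤ R₀ * S₁)
    (h₇ : u₁ * (v₀ + 1) ≤ R₁ * S₀) (h₈ : u₁ * (v₁ + 1) ≤ R₁ * S₁)
    (hpos : 0 < (R₀ + R₁) * (S₀ + S₁)) (heq : R₀ = R₁ → S₀ = S₁ → R₀ = S₀) :
    (u₀ + u₁ + 1) * (v₀ + v₁ + 1) ≤ (R₀ + R₁) * (S₀ + S₁) := by
  by_contra! hlt
  have e₁ : u₀ = v₀ := by nlinarith
  have e₂ : u₀ = v₁ := by nlinarith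
  have e₃ : u₁ = v₀ := by nlinarith
  subst e₁ e₂ e₃
  have f₁ : (u₁ + 1) * u₁ = R₀ * S₀ := by nlinarith
  have f₂ : (u₁ + 1) * u₁ = R₀ * S₁ := by nlinarith
  have f₃ : (u₁ + 1) * u₁ = R₁ * S₀ := by nlinarith
  rcases Nat.eq_zero_or_pos u₁ with rfl | hu
  · omega
  have hp : 0 < R₀ * S₀ := by rw [← f₁]; positivity
  have hR : 0 < R₀ := Nat.pos_of_mul_pos_right hp
  have hS : 0 < S₀ := Nat.pos_of_mul_pos_left hp
  have hS' : S₀ = S₁ := Nat.eq_of_mul_eq_mul_left hR (f₁.symm.trans f₂)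
  have hR' : R₀ = R₁ := Nat.eq_of_mul_eq_mul_right hS (f₁.symm.trans f₃)
  have hRS := heq hR' hS'
  rw [← hRS] at f₁
  rcases Nat.lt_or_ge u₁ R₀ with h | h <;> nlinarith

lemma starCard_product_bound_succ {n : ℕ}
    (ih : ∀ (r s : ℕ) (𝒜 ℬ : Finset (Finset ℕ)), CrossIntersecting 𝒜 ℬ →
      BoundedFamily (n + 1) r 𝒜 → BoundedFamily (n + 1) s ℬ →
      #𝒜 * #ℬ ≤ starCard n r * starCard n s)
    (r s : ℕ) (𝒜 ℬ : Finset (Finset ℕ)) (h : CrossIntersecting 𝒜 ℬ)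
    (h𝒜 : BoundedFamily (n + 2) (r + 1) 𝒜) (hℬ : BoundedFamily (n + 2) (s + 1) ℬ) :
    #𝒜 * #ℬ ≤ starCard (n + 1) (r + 1) * starCard (n + 1) (s + 1) := by
  obtain ⟨𝒜', ℬ', h', h𝒜', hℬ', hc𝒜, hcℬ, hst⟩ := h.exists_stable h𝒜 hℬ
  rw [← hc𝒜, ← hcℬ]
  clear hc𝒜 hcℬ h𝒜 hℬ h
  have h₀₀ : CrossIntersecting (𝒜'.nonMemberSubfamily (n + 2)) (ℬ'.nonMemberSubfamily (n + 2)) :=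
    fun A hA B hB ↦ h' A (mem_nonMemberSubfamily.1 hA).1 B (mem_nonMemberSubfamily.1 hB).1
  have h₀₁ : CrossIntersecting (𝒜'.nonMemberSubfamily (n + 2)) (ℬ'.memberSubfamily (n + 2)) := by
    intro A hA B hB
    rw [mem_nonMemberSubfamily] at hA
    simpa [inter_insert_of_notMem hA.2] using h' A hA.1 _ (mem_memberSubfamily.1 hB).1
  have h₁₀ : CrossIntersecting (𝒜'.memberSubfamily (n + 2)) (ℬ'.nonMemberSubfamily (n + 2)) := by
    intro A hA B hB
    rw [mem_nonMemberSubfamily] at hB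
    simpa [insert_inter_of_notMem hB.2] using h' _ (mem_memberSubfamily.1 hA).1 B hB.1
  have bA₁ := h𝒜'.memberSubfamily
  have bB₁ := hℬ'.memberSubfamily
  have h₁₁ : ∀ A ∈ 𝒜'.memberSubfamily (n + 2), ∀ B ∈ ℬ'.memberSubfamily (n + 2),
      ¬ (A ∩ B).Nonempty → B = Icc 1 (n + 1) \ A := by
    intro A hA B hB hne
    have hAs := (bA₁ A hA).1
    have hBs := (bB₁ B hB).1
    rw [mem_memberSubfamily] at hA hB
    ext x
    rw [mem_sdiff]
    refine ⟨fun hx ↦ ⟨hBs hx, fun hxA ↦ hne ⟨x, mem_inter.2 ⟨hxA, hx⟩⟩⟩, fun ⟨hx, hxA⟩ ↦ ?_⟩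
    by_contra hxB
    have hx' := mem_Icc.1 hx
    have hmem := hst _ hA.1 x (mem_Icc.2 (by omega)) (by grind) (mem_insert_self _ _)
    obtain ⟨y, hy⟩ := h' _ hmem _ hB.1
    exact hne ⟨y, by grind⟩
  have key := fun 𝒟 ℰ ↦ product_bounds_of_complementary (𝒟 := 𝒟) (ℰ := ℰ) (f := starCard n) ih
    h𝒜'.nonMemberSubfamily bA₁ hℬ'.nonMemberSubfamily bB₁ h₀₀ h₀₁ h₁₀ h₁₁
  rw [← card_memberSubfamily_add_card_nonMemberSubfamily (n + 2) 𝒜',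
    ← card_memberSubfamily_add_card_nonMemberSubfamily (n + 2) ℬ',
    starCard_succ_succ, starCard_succ_succ]
  have hpos : 0 < (starCard n (r + 1) + starCard n r) * (starCard n (s + 1) + starCard n s) :=
    Nat.mul_pos (Nat.add_pos_left (starCard_succ_pos n r) _)
      (Nat.add_pos_left (starCard_succ_pos n s) _)
  have heq : starCard n (r + 1) = starCard n r → starCard n (s + 1) = starCard n s →
      starCard n (r + 1) = starCard n (s + 1) := fun hr hs ↦ by
    rw [starCard_succ_of_le (lt_of_starCard_succ_eq hr).le,
      starCard_succ_of_le (lt_of_starCard_succ_eq hs).le]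
  generalize 𝒜'.nonMemberSubfamily (n + 2) = 𝒜₀ at *
  generalize 𝒜'.memberSubfamily (n + 2) = 𝒜₁ at *
  generalize ℬ'.nonMemberSubfamily (n + 2) = ℬ₀ at *
  generalize ℬ'.memberSubfamily (n + 2) = ℬ₁ at *
  set 𝒞 : Finset (Finset ℕ) := {A ∈ 𝒜₁ | Icc 1 (n + 1) \ A ∈ ℬ₁} with h𝒞
  have hsplit : ∀ p q, p + q = #𝒞 → ∃ 𝒟 ℰ : Finset (Finset ℕ),
      Disjoint 𝒟 ℰ ∧ 𝒟 ∪ ℰ = 𝒞 ∧ #𝒟 = p ∧ #ℰ = q := by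
    intro p q hpq
    obtain ⟨𝒟, hs, hc⟩ := exists_subset_card_eq (s := 𝒞) (n := p) (by omega)
    refine ⟨𝒟, 𝒞 \ 𝒟, disjoint_sdiff, union_sdiff_of_subset hs, hc, ?_⟩
    rw [card_sdiff_of_subset hs]
    omega
  have hcA : #𝒞 ≤ #𝒜₁ := card_filter_le _ _
  have hcB : #𝒞 ≤ #ℬ₁ := by
    refine card_le_card_of_injOn (Icc 1 (n + 1) \ ·) (fun A hA ↦ (mem_filter.1 hA).2) ?_
    exact fun A hA A' hA' ↦ bA₁.injOn_compl (mem_filter.1 hA).1 (mem_filter.1 hA').1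
  have bounds : ∀ p q, p + q = #𝒞 →
      (#𝒜₀ + q) * (#ℬ₀ + p) ≤ starCard n (r + 1) * starCard n (s + 1) ∧
      (#𝒜₀ + q) * (#ℬ₁ - q) ≤ starCard n (r + 1) * starCard n s ∧
      (#𝒜₁ - p) * (#ℬ₀ + p) ≤ starCard n r * starCard n (s + 1) ∧
      (#𝒜₁ - p) * (#ℬ₁ - q) ≤ starCard n r * starCard n s := fun p q hpq ↦ by
    obtain ⟨𝒟, ℰ, hd, hu, hp, hq⟩ := hsplit p q hpq
    have := key 𝒟 ℰ hd hu
    rw [hp, hq] at this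
    exact this
  rcases Nat.even_or_odd' #𝒞 with ⟨y, hy | hy⟩
  · obtain ⟨k₁, k₂, k₃, k₄⟩ := bounds y y (by omega)
    obtain ⟨a, ha⟩ := Nat.exists_eq_add_of_le (show y ≤ #𝒜₁ by omega)
    obtain ⟨b, hb⟩ := Nat.exists_eq_add_of_le (show y ≤ #ℬ₁ by omega)
    rw [ha, Nat.add_sub_cancel_left] at k₃ k₄
    rw [hb, Nat.add_sub_cancel_left] at k₂ k₄
    rw [ha, hb]
    nlinarith
  · obtain ⟨k₁, k₂, k₃, k₄⟩ := bounds y (y + 1) (by omega)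
    obtain ⟨l₁, l₂, l₃, l₄⟩ := bounds (y + 1) y (by omega)
    obtain ⟨a, ha⟩ := Nat.exists_eq_add_of_le (show y + 1 ≤ #𝒜₁ by omega)
    obtain ⟨b, hb⟩ := Nat.exists_eq_add_of_le (show y + 1 ≤ #ℬ₁ by omega)
    have ea : #𝒜₁ - y = a + 1 := by omega
    have ea' : #𝒜₁ - (y + 1) = a := by omega
    have eb : #ℬ₁ - y = b + 1 := by omega
    have eb' : #ℬ₁ - (y + 1) = b := by omega
    rw [ea] at k₃ k₄
    rw [ea'] at l₃ l₄
    rw [eb'] at k₂ k₄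
    rw [eb] at l₂ l₄
    have := product_le_of_odd_split (u₀ := #𝒜₀ + y) (v₀ := #ℬ₀ + y) k₁ k₂ k₃ k₄ l₁ l₂ l₃ l₄ hpos heq
    convert this using 2 <;> omega

/-- The product bound for two families on the same ground set. -/
lemma starCard_product_bound_diag (n r s : ℕ) (𝒜 ℬ : Finset (Finset ℕ))
    (h : CrossIntersecting 𝒜 ℬ) (h𝒜 : BoundedFamily (n + 1) r 𝒜)
    (hℬ : BoundedFamily (n + 1) s ℬ) : #𝒜 * #ℬ ≤ starCard n r * starCard n s := by
  induction n generalizing r s 𝒜 ℬ with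
  | zero =>
    rcases r with _ | r
    · rw [mul_comm, h.symm.card_mul_card_eq_zero h𝒜]
      exact Nat.zero_le _
    rcases s with _ | s
    · rw [h.card_mul_card_eq_zero hℬ]
      exact Nat.zero_le _
    rcases 𝒜.eq_empty_or_nonempty with rfl | ⟨A₀, hA₀⟩
    · simp
    rcases ℬ.eq_empty_or_nonempty with rfl | ⟨B₀, hB₀⟩
    · simp
    have hA : 𝒜 ⊆ {{1}} := fun A hA ↦ by
      rcases subset_singleton_iff.1 (h𝒜 A hA).1 with rfl | rfl
      · simpa using h _ hA _ hB₀
      · simp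
    have hB : ℬ ⊆ {{1}} := fun B hB ↦ by
      rcases subset_singleton_iff.1 (hℬ B hB).1 with rfl | rfl
      · simpa using h _ hA₀ _ hB
      · simp
    exact Nat.mul_le_mul ((card_le_card hA).trans (starCard_succ_pos 0 r))
      ((card_le_card hB).trans (starCard_succ_pos 0 s))
  | succ n ih =>
    rcases r with _ | r
    · rw [mul_comm, h.symm.card_mul_card_eq_zero h𝒜]
      exact Nat.zero_le _
    rcases s with _ | s
    · rw [h.card_mul_card_eq_zero hℬ]
      exact Nat.zero_le _
    exact starCard_product_bound_succ ih r s 𝒜 ℬ h h𝒜 hℬ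

lemma starCard_product_bound_of_le {m n : ℕ} (hmn : m ≤ n) (r s : ℕ) (𝒜 ℬ : Finset (Finset ℕ))
    (h : CrossIntersecting 𝒜 ℬ) (h𝒜 : BoundedFamily (m + 1) r 𝒜)
    (hℬ : BoundedFamily (n + 1) s ℬ) : #𝒜 * #ℬ ≤ starCard m r * starCard n s := by
  induction n, hmn using Nat.le_induction generalizing s ℬ with
  | base => exact starCard_product_bound_diag m r s 𝒜 ℬ h h𝒜 hℬ
  | succ n hmn ih =>
    rcases s with _ | s
    · rw [h.card_mul_card_eq_zero hℬ]
      exact Nat.zero_le _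
    have h₀ : CrossIntersecting 𝒜 (ℬ.nonMemberSubfamily (n + 2)) :=
      fun A hA B hB ↦ h A hA B (mem_nonMemberSubfamily.1 hB).1
    have h₁ : CrossIntersecting 𝒜 (ℬ.memberSubfamily (n + 2)) := by
      intro A hA B hB
      have hnA : n + 2 ∉ A := fun hn ↦ by
        have := (mem_Icc.1 ((h𝒜 A hA).1 hn)).2
        omega
      simpa [inter_insert_of_notMem hnA] using h A hA _ (mem_memberSubfamily.1 hB).1
    rw [← card_memberSubfamily_add_card_nonMemberSubfamily (n + 2) ℬ, starCard_succ_succ,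
      mul_add, mul_add, add_comm]
    exact Nat.add_le_add (ih _ _ h₀ hℬ.nonMemberSubfamily) (ih _ _ h₁ hℬ.memberSubfamily)

lemma sum_Icc_choose_pred (n s : ℕ) :
    ∑ j ∈ Icc 1 s, n.choose (j - 1) = starCard n s := by
  rw [starCard, range_eq_Ico]
  exact (sum_Ico_add' (fun j ↦ n.choose (j - 1)) 0 s 1).symm

/-- Cross-intersecting families of small subsets of [m] and [n]:
`|A| * |B| ≤ (∑_{i=0}^r C(m-1,i-1)) * (∑_{j=0}^s C(n-1,j-1))`
(the `i = 0` and `j = 0` terms vanish since `C(a,-1) = 0`). -/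
theorem cross_intersecting_product_bound
    (m n r s : ℕ) (hr1 : 1 ≤ r) (hrm : r ≤ m) (hs1 : 1 ≤ s) (hsn : s ≤ n)
    (𝒜 ℬ : Finset (Finset ℕ))
    (h𝒜 : ∀ A ∈ 𝒜, A ⊆ Finset.Icc 1 m ∧ A.card ≤ r)
    (hℬ : ∀ B ∈ ℬ, B ⊆ Finset.Icc 1 n ∧ B.card ≤ s)
    (hcross : ∀ A ∈ 𝒜, ∀ B ∈ ℬ, (A ∩ B).Nonempty) :
    𝒜.card * ℬ.card ≤
      (∑ i ∈ Finset.Icc 1 r, Nat.choose (m - 1) (i - 1)) *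
        (∑ j ∈ Finset.Icc 1 s, Nat.choose (n - 1) (j - 1)) := by
  obtain ⟨m, rfl⟩ := Nat.exists_eq_add_of_le' (hr1.trans hrm)
  obtain ⟨n, rfl⟩ := Nat.exists_eq_add_of_le' (hs1.trans hsn)
  simp only [Nat.add_sub_cancel, sum_Icc_choose_pred]
  rcases le_total m n with hmn | hmn
  · exact starCard_product_bound_of_le hmn r s 𝒜 ℬ hcross h𝒜 hℬ
  · rw [mul_comm, mul_comm (starCard m r)]
    exact starCard_product_bound_of_le hmn s r ℬ 𝒜 (CrossIntersecting.symm hcross) hℬ h𝒜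
end

section
/- Let k ≥ 2, and for each i ∈ [k] let r_i ∈ [n_i] and A_i ⊆ {subsets of [n_i] of size ≤ r_i}. If A_1, ..., A_k are cross-intersecting, then ∏_{i=1}^k |A_i| ≤ ∏_{i=1}^k (∑_{j=1}^{r_i} C(n_i - 1, j - 1)). -/
open Finset

namespace CrossIntersecting

variable {α : Type*}

/-- Every member of `𝒜` is a subset of `V` of size at most `r`. -/
def BoundedIn (V : Finset α) (r : ℕ) (𝒜 : Finset (Finset α)) : Prop :=
  ∀ A ∈ 𝒜, A ⊆ V ∧ #A ≤ r

/-- Every member of `𝒜` meets every member of `ℬ`. -/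
def Cross (𝒜 ℬ : Finset (Finset α)) : Prop :=
  ∀ A ∈ 𝒜, ∀ B ∈ ℬ, ¬ Disjoint A B

theorem Cross.symm {𝒜 ℬ : Finset (Finset α)} (h : Cross 𝒜 ℬ) : Cross ℬ 𝒜 :=
  fun B hB A hA hd => h A hA B hB hd.symm

/-- The number of subsets of size at most `r` of an `(n + 1)`-set that contain a fixed element. -/
def starSize (n r : ℕ) : ℕ := ∑ j ∈ range r, n.choose j

theorem starSize_succ_left (n r : ℕ) :
    starSize (n + 1) r = starSize n r + starSize n (r - 1) := by
  cases r with
  | zero => simp [starSize]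
  | succ r =>
    simp only [starSize, Nat.add_sub_cancel]
    rw [sum_range_succ', sum_range_succ' (fun j => n.choose j)]
    simp only [Nat.choose_succ_succ, sum_add_distrib, Nat.choose_zero_right]
    ring

theorem starSize_pos {n r : ℕ} (hr : 0 < r) : 0 < starSize n r :=
  sum_pos' (fun _ _ => Nat.zero_le _) ⟨0, by simpa using hr, by simp⟩

theorem starSize_of_lt {n r : ℕ} (hr : n < r) : starSize n r = starSize n (n + 1) := by
  symm
  refine sum_subset (range_subset_range.2 hr) fun j _ hj => ?_
  exact Nat.choose_eq_zero_of_lt (by simpa using hj)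

theorem lt_of_starSize_pred_eq {n r : ℕ} (hr : 0 < r)
    (h : starSize n r = starSize n (r - 1)) : n + 1 < r := by
  obtain ⟨r, rfl⟩ := Nat.exists_eq_add_one.2 hr
  rw [Nat.add_sub_cancel, starSize, sum_range_succ, starSize, Nat.add_eq_left,
    Nat.choose_eq_zero_iff] at h
  omega

theorem BoundedIn.mono {V : Finset α} {r r' : ℕ} {𝒜 ℬ : Finset (Finset α)}
    (h : BoundedIn V r 𝒜) (hr : r ≤ r') (hs : ℬ ⊆ 𝒜) : BoundedIn V r' ℬ :=
  fun A hA => ⟨(h A (hs hA)).1, (h A (hs hA)).2.trans hr⟩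

theorem card_mul_card_le_of_card_eq_one {V : Finset α} (hV : #V = 1) {r s : ℕ}
    {𝒜 ℬ : Finset (Finset α)} (h𝒜 : BoundedIn V r 𝒜) (hℬ : BoundedIn V s ℬ) (h : Cross 𝒜 ℬ) :
    #𝒜 * #ℬ ≤ starSize 0 r * starSize 0 s := by
  have key : ∀ {r : ℕ} {𝒜 ℬ : Finset (Finset α)}, BoundedIn V r 𝒜 → Cross 𝒜 ℬ →
      ℬ.Nonempty → #𝒜 ≤ starSize 0 r := by
    rintro r 𝒜 ℬ h𝒜 h ⟨B, hB⟩
    have hne : ∀ A ∈ 𝒜, A = V ∧ 0 < r := by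
      intro A hA
      obtain ⟨h1, h2⟩ := h𝒜 A hA
      have h3 : 0 < #A := card_pos.2 <| nonempty_iff_ne_empty.2 fun h0 =>
        h A hA B hB (h0 ▸ disjoint_empty_left B)
      exact ⟨eq_of_subset_of_card_le h1 (by omega), by omega⟩
    rcases 𝒜.eq_empty_or_nonempty with rfl | ⟨A, hA⟩
    · simp
    · exact (card_le_one.2 fun A hA B hB => (hne A hA).1.trans (hne B hB).1.symm).trans
        (starSize_pos (hne A hA).2)
  rcases 𝒜.eq_empty_or_nonempty with rfl | hA
  · simp
  rcases ℬ.eq_empty_or_nonempty with rfl | hB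
  · simp
  exact Nat.mul_le_mul (key h𝒜 h hB) (key hℬ h.symm hA)

variable [DecidableEq α]

/-- The compression `𝓒 {j} {v}` preserves the cross-intersection property. -/
theorem Cross.compression {𝒜 ℬ : Finset (Finset α)} (h : Cross 𝒜 ℬ) {j v : α} (hjv : j ≠ v) :
    Cross (UV.compression {j} {v} 𝒜) (UV.compression {j} {v} ℬ) := by
  have key : ∀ {𝒜 ℬ : Finset (Finset α)}, Cross 𝒜 ℬ → ∀ A ∈ 𝒜, UV.compress {j} {v} A ∉ 𝒜 →
      ∀ B ∈ ℬ, UV.compress {j} {v} B ∈ ℬ → ¬ Disjoint (UV.compress {j} {v} A) B := by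
    intro 𝒜 ℬ h A hA hA' B hB hB' hd
    have h1 := h A hA B hB
    have h2 := h A hA _ hB'
    unfold UV.compress at hA' hB' hd h2
    simp only [sup_eq_union, disjoint_singleton_left, singleton_subset_iff] at hA' hB' hd h2
    rw [disjoint_left] at h1
    split_ifs at * <;> rw [disjoint_left] at hd h2 <;> grind
  have key' : ∀ {𝒜 : Finset (Finset α)}, ∀ A ∈ 𝒜, UV.compress {j} {v} A ∉ 𝒜 →
      j ∈ UV.compress {j} {v} A := by
    intro 𝒜 A hA hA'
    unfold UV.compress at hA' ⊢
    split_ifs at * <;> simp_all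
  intro A hA B hB hd
  rw [UV.mem_compression] at hA hB
  rcases hA with ⟨hA, hA'⟩ | ⟨hA, A', hA', rfl⟩ <;> rcases hB with ⟨hB, hB'⟩ | ⟨hB, B', hB', rfl⟩
  · exact h A hA B hB hd
  · exact key h.symm _ hB' hB _ hA hA' hd.symm
  · exact key h _ hA' hA _ hB hB' hd
  · exact disjoint_left.1 hd (key' _ hA' hA) (key' _ hB' hB)

theorem BoundedIn.compression {V : Finset α} {r : ℕ} {𝒜 : Finset (Finset α)}
    (h : BoundedIn V r 𝒜) {j v : α} (hj : j ∈ V) :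
    BoundedIn V r (UV.compression {j} {v} 𝒜) := by
  intro A hA
  rw [UV.mem_compression] at hA
  rcases hA with ⟨hA, -⟩ | ⟨-, A', hA', rfl⟩
  · exact h A hA
  · refine ⟨?_, (UV.card_compress (by simp) A').trans_le (h A' hA').2⟩
    have := (h A' hA').1
    unfold UV.compress
    split_ifs
    · intro x hx
      simp only [sup_eq_union, mem_sdiff, mem_union, mem_singleton] at hx
      grind
    · exact this

theorem nonMemberSubfamily_subset_compression {𝒜 : Finset (Finset α)} {j v : α} :
    𝒜.nonMemberSubfamily v ⊆ (UV.compression {j} {v} 𝒜).nonMemberSubfamily v := by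
  intro A hA
  rw [mem_nonMemberSubfamily] at hA ⊢
  refine ⟨UV.mem_compression.2 (Or.inl ⟨hA.1, ?_⟩), hA.2⟩
  rw [UV.compress, if_neg (by simp [hA.2])]
  exact hA.1

/-- `ℬ`-saturation: `𝒜` contains every admissible set meeting all of `ℬ`. -/
def Saturated (V : Finset α) (r : ℕ) (𝒜 ℬ : Finset (Finset α)) : Prop :=
  ∀ X ⊆ V, #X ≤ r → (∀ B ∈ ℬ, ¬ Disjoint X B) → X ∈ 𝒜

/-- Cross-intersecting families may be enlarged so that both are saturated and the first is
stable under replacing `v` by any other element of the ground set. -/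
theorem exists_saturated_shifted {V : Finset α} {v : α} {r s : ℕ}
    {𝒜 ℬ : Finset (Finset α)} (h𝒜 : BoundedIn V r 𝒜) (hℬ : BoundedIn V s ℬ) (h : Cross 𝒜 ℬ) :
    ∃ 𝒜' ℬ' : Finset (Finset α), BoundedIn V r 𝒜' ∧ BoundedIn V s ℬ' ∧ Cross 𝒜' ℬ' ∧
      #𝒜 ≤ #𝒜' ∧ #ℬ ≤ #ℬ' ∧ Saturated V r 𝒜' ℬ' ∧ Saturated V s ℬ' 𝒜' ∧
      ∀ A ∈ 𝒜', v ∈ A → ∀ j ∈ V, j ∉ A → insert j (A.erase v) ∈ 𝒜' := by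
  classical
  let T : Finset (Finset (Finset α) × Finset (Finset α)) :=
    {p ∈ V.powerset.powerset ×ˢ V.powerset.powerset | BoundedIn V r p.1 ∧ BoundedIn V s p.2 ∧
      Cross p.1 p.2 ∧ #𝒜 ≤ #p.1 ∧ #ℬ ≤ #p.2}
  have hT : ∀ 𝒞 𝒟, (𝒞, 𝒟) ∈ T ↔ BoundedIn V r 𝒞 ∧ BoundedIn V s 𝒟 ∧ Cross 𝒞 𝒟 ∧
      #𝒜 ≤ #𝒞 ∧ #ℬ ≤ #𝒟 := by
    intro 𝒞 𝒟
    simp only [T, mem_filter, mem_product, mem_powerset, and_iff_right_iff_imp]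
    rintro ⟨h1, h2, -⟩
    exact ⟨fun A hA => mem_powerset.2 (h1 A hA).1, fun A hA => mem_powerset.2 (h2 A hA).1⟩
  obtain ⟨⟨𝒞, 𝒟⟩, hm, hmax⟩ := exists_max_image T
    (fun p => #p.1 + #p.2 + (#(p.1.nonMemberSubfamily v) + #(p.2.nonMemberSubfamily v)))
    ⟨(𝒜, ℬ), (hT _ _).2 ⟨h𝒜, hℬ, h, le_rfl, le_rfl⟩⟩
  obtain ⟨b1, b2, hc, hle1, hle2⟩ := (hT _ _).1 hm
  refine ⟨𝒞, 𝒟, b1, b2, hc, hle1, hle2, ?_, ?_, ?_⟩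
  · intro X hXV hXr hX
    by_contra hX'
    have h1 := hmax (insert X 𝒞, 𝒟) ((hT _ _).2 ⟨?_, b2, ?_, ?_, hle2⟩)
    · have h2 : #(𝒞.nonMemberSubfamily v) ≤ #((insert X 𝒞).nonMemberSubfamily v) :=
        card_le_card (filter_subset_filter _ (subset_insert _ _))
      simp only [card_insert_of_notMem hX'] at h1
      omega
    · exact fun A hA => (mem_insert.1 hA).elim (fun e => e ▸ ⟨hXV, hXr⟩) (b1 A)
    · exact fun A hA => (mem_insert.1 hA).elim (fun e => e ▸ hX) (hc A)
    · exact hle1.trans (card_le_card (subset_insert _ _))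
  · intro X hXV hXr hX
    by_contra hX'
    have h1 := hmax (𝒞, insert X 𝒟) ((hT _ _).2 ⟨b1, ?_, Cross.symm ?_, hle1, ?_⟩)
    · have h2 : #(𝒟.nonMemberSubfamily v) ≤ #((insert X 𝒟).nonMemberSubfamily v) :=
        card_le_card (filter_subset_filter _ (subset_insert _ _))
      simp only [card_insert_of_notMem hX'] at h1
      omega
    · exact fun A hA => (mem_insert.1 hA).elim (fun e => e ▸ ⟨hXV, hXr⟩) (b2 A)
    · exact fun A hA => (mem_insert.1 hA).elim (fun e => e ▸ hX) (hc.symm A)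
    · exact hle2.trans (card_le_card (subset_insert _ _))
  · intro A hA hv j hj hjA
    by_contra hX'
    have hjv : j ≠ v := fun e => hjA (e ▸ hv)
    have h1 := hmax (UV.compression {j} {v} 𝒞, UV.compression {j} {v} 𝒟)
      ((hT _ _).2 ⟨b1.compression hj, b2.compression hj, hc.compression hjv,
        by rwa [UV.card_compression], by rwa [UV.card_compression]⟩)
    have h2 : #(𝒟.nonMemberSubfamily v) ≤ _ :=
      card_le_card (nonMemberSubfamily_subset_compression (j := j))
    have h3 : #(𝒞.nonMemberSubfamily v) <
        #((UV.compression {j} {v} 𝒞).nonMemberSubfamily v) := by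
      refine card_lt_card ⟨nonMemberSubfamily_subset_compression, fun hs => hX' ?_⟩
      have he : UV.compress {j} {v} A = insert j (A.erase v) := by
        rw [UV.compress, if_pos (by simp [hjA, hv])]
        ext x
        simp only [sup_eq_union, mem_sdiff, mem_union, mem_singleton, mem_insert, mem_erase]
        grind
      refine (mem_nonMemberSubfamily.1 (hs (mem_nonMemberSubfamily.2 ⟨?_, ?_⟩))).1
      · rw [← he]
        exact UV.compress_mem_compression hA
      · simp [hjv.symm]
    simp only [UV.card_compression] at h1
    omega

/-- Numerical form of the induction step. -/
theorem mul_le_mul_of_exchange {a b p q x F₀ F₁ G₀ G₁ : ℕ} (hpa : p ≤ a) (hqb : q ≤ b)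
    (hF : 0 < F₀ + F₁) (hG : 0 < G₀ + G₁) (hFG : F₀ = F₁ → G₀ = G₁ → F₀ = G₀)
    (H : ∀ i j, i + j = x → (a + i) * (b + j) ≤ F₀ * G₀ ∧ (a + i) * (q + j) ≤ F₀ * G₁ ∧
      (p + i) * (b + j) ≤ F₁ * G₀ ∧ (p + i) * (q + j) ≤ F₁ * G₁) :
    (a + (p + x)) * (b + (q + x)) ≤ (F₀ + F₁) * (G₀ + G₁) := by
  obtain ⟨y, rfl | rfl⟩ := Nat.even_or_odd' x
  · obtain ⟨h1, h2, h3, h4⟩ := H y y (by ring)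
    nlinarith
  obtain ⟨h1, h2, h3, h4⟩ := H y (y + 1) (by ring)
  obtain ⟨k1, k2, k3, k4⟩ := H (y + 1) y (by ring)
  rcases lt_trichotomy (a + p) (b + q) with hlt | heq | hgt
  · nlinarith
  · rcases hpa.lt_or_eq with hlt | rfl
    · nlinarith
    rcases hqb.lt_or_eq with hlt | rfl
    · nlinarith
    obtain rfl : p = q := by omega
    by_contra! hcon
    obtain ⟨c, hc⟩ : ∃ c, c = p + y := ⟨_, rfl⟩
    rw [← add_assoc, ← hc] at h1 h2 k3 k4
    have hcon' : (F₀ + F₁) * (G₀ + G₁) < 4 * (c * (c + 1)) + 1 := by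
      rw [hc]
      linarith
    rw [add_mul, mul_add, mul_add] at hcon'
    rw [mul_comm (c + 1)] at k3 k4
    have e1 : F₀ * G₀ = c * (c + 1) := by omega
    have e2 : F₀ * G₁ = c * (c + 1) := by omega
    have e3 : F₁ * G₀ = c * (c + 1) := by omega
    have hpos := Nat.mul_pos hF hG
    have hc0 : 0 < c := by
      by_contra! h0
      obtain rfl : c = 0 := by omega
      rw [add_mul, mul_add, mul_add] at hpos
      omega
    have hp : 0 < F₀ * G₀ := by rw [e1]; positivity
    have hF0 := Nat.pos_of_mul_pos_right hp
    have hG0 := Nat.pos_of_mul_pos_left hp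
    have f1 : F₀ = F₁ := Nat.eq_of_mul_eq_mul_right hG0 (e1.trans e3.symm)
    have f2 : G₀ = G₁ := Nat.eq_of_mul_eq_mul_left hF0 (e1.trans e2.symm)
    have f3 := hFG f1 f2
    rw [← f3] at e1
    have l1 : c < F₀ := by nlinarith
    nlinarith
  · nlinarith

/-- If `X ∪ {v} ∈ 𝒜` and `Y ∪ {v} ∈ ℬ` with `X`, `Y` disjoint, then `Y` is the complement
of `X`. -/
theorem eq_sdiff_of_disjoint {W : Finset α} {v : α} (hv : v ∉ W) {s : ℕ}
    {𝒜 ℬ : Finset (Finset α)} (hℬ : BoundedIn (insert v W) s ℬ) (h : Cross 𝒜 ℬ)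
    (hshift : ∀ A ∈ 𝒜, v ∈ A → ∀ j ∈ insert v W, j ∉ A → insert j (A.erase v) ∈ 𝒜)
    {X Y : Finset α} (hX : X ∈ 𝒜.memberSubfamily v) (hY : Y ∈ ℬ.memberSubfamily v)
    (hd : Disjoint X Y) : Y = W \ X := by
  rw [mem_memberSubfamily] at hX hY
  have hYW := (hℬ _ hY.1).1
  rw [insert_subset_insert_iff hY.2] at hYW
  refine subset_antisymm (subset_sdiff.2 ⟨hYW, hd.symm⟩) fun j hj => ?_
  by_contra hjY
  rw [mem_sdiff] at hj
  have hjv : j ≠ v := fun e => hv (e ▸ hj.1)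
  have hA := hshift _ hX.1 (mem_insert_self _ _) j (mem_insert_of_mem hj.1)
    (by simp [hjv, hj.2])
  rw [erase_insert hX.2] at hA
  refine h _ hA _ hY.1 ?_
  rw [disjoint_left] at hd ⊢
  grind

theorem BoundedIn.memberSubfamily {W : Finset α} {v : α} {r : ℕ}
    {𝒜 : Finset (Finset α)} (h : BoundedIn (insert v W) r 𝒜) :
    BoundedIn W (r - 1) (𝒜.memberSubfamily v) := by
  intro A hA
  rw [mem_memberSubfamily] at hA
  obtain ⟨h1, h2⟩ := h _ hA.1
  rw [insert_subset_insert_iff hA.2] at h1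
  rw [card_insert_of_notMem hA.2] at h2
  exact ⟨h1, by omega⟩

theorem BoundedIn.nonMemberSubfamily {W : Finset α} {v : α} {r : ℕ}
    {𝒜 : Finset (Finset α)} (h : BoundedIn (insert v W) r 𝒜) :
    BoundedIn W r (𝒜.nonMemberSubfamily v) := by
  intro A hA
  rw [mem_nonMemberSubfamily] at hA
  obtain ⟨h1, h2⟩ := h _ hA.1
  exact ⟨(subset_insert_iff_of_notMem hA.2).1 h1, h2⟩

/-- For saturated and shifted cross-intersecting families, a set of the link of `v` in `𝒜` whose
complement is not in the link of `v` in `ℬ` already belongs to `𝒜`. -/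
theorem mem_nonMemberSubfamily_of_saturated {W : Finset α} {v : α} {r : ℕ}
    {𝒜 ℬ : Finset (Finset α)} (h𝒜 : BoundedIn (insert v W) r 𝒜) (h : Cross 𝒜 ℬ)
    (hsat : Saturated (insert v W) r 𝒜 ℬ)
    (hcompl : ∀ X ∈ 𝒜.memberSubfamily v, ∀ Y ∈ ℬ.memberSubfamily v, Disjoint X Y → Y = W \ X)
    {X : Finset α} (hX : X ∈ 𝒜.memberSubfamily v) (hXc : W \ X ∉ ℬ.memberSubfamily v) :
    X ∈ 𝒜.nonMemberSubfamily v := by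
  have hX' := mem_memberSubfamily.1 hX
  obtain ⟨h1, h2⟩ := h𝒜 _ hX'.1
  refine mem_nonMemberSubfamily.2 ⟨hsat X ((subset_insert _ _).trans h1)
    ((card_le_card (subset_insert _ _)).trans h2) fun B hB hd => hXc ?_, hX'.2⟩
  have hvB : v ∈ B := by
    by_contra hvB
    exact h _ hX'.1 B hB (disjoint_insert_left.2 ⟨hvB, hd⟩)
  have hY : B.erase v ∈ ℬ.memberSubfamily v :=
    mem_memberSubfamily.2 ⟨by rwa [insert_erase hvB], notMem_erase _ _⟩
  exact hcompl X hX _ hY (hd.mono_right (erase_subset _ _)) ▸ hY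

theorem BoundedIn.union {V : Finset α} {r : ℕ} {𝒜 ℬ : Finset (Finset α)}
    (h𝒜 : BoundedIn V r 𝒜) (hℬ : BoundedIn V r ℬ) : BoundedIn V r (𝒜 ∪ ℬ) :=
  fun A hA => (mem_union.1 hA).elim (h𝒜 A) (hℬ A)

/-- The product bound for two cross-intersecting families on the same ground set. -/
theorem card_mul_card_le {n : ℕ} {V : Finset α} (hV : #V = n + 1) {r s : ℕ}
    {𝒜 ℬ : Finset (Finset α)} (h𝒜 : BoundedIn V r 𝒜) (hℬ : BoundedIn V s ℬ) (h : Cross 𝒜 ℬ) :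
    #𝒜 * #ℬ ≤ starSize n r * starSize n s := by
  induction n generalizing V r s 𝒜 ℬ with
  | zero => exact card_mul_card_le_of_card_eq_one hV h𝒜 hℬ h
  | succ n ih =>
  obtain ⟨v, W, hv, rfl, hW⟩ := card_eq_succ.1 hV
  obtain ⟨𝒞, 𝒟, h𝒞, h𝒟, hc, hle1, hle2, sat1, sat2, hshift⟩ :=
    exists_saturated_shifted (v := v) h𝒜 hℬ h
  refine (Nat.mul_le_mul hle1 hle2).trans ?_
  clear hle1 hle2 h h𝒜 hℬ 𝒜 ℬ
  rcases 𝒞.eq_empty_or_nonempty with rfl | ⟨A, hA⟩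
  · simp
  rcases 𝒟.eq_empty_or_nonempty with rfl | ⟨B, hB⟩
  · simp
  have hr : 0 < r := by
    refine (card_pos.2 <| nonempty_iff_ne_empty.2 fun h0 => ?_).trans_le (h𝒞 A hA).2
    exact hc A hA B hB (h0 ▸ disjoint_empty_left B)
  have hs : 0 < s := by
    refine (card_pos.2 <| nonempty_iff_ne_empty.2 fun h0 => ?_).trans_le (h𝒟 B hB).2
    exact hc A hA B hB (h0 ▸ disjoint_empty_right A)
  have b0 := h𝒞.nonMemberSubfamily
  have b1 := h𝒞.memberSubfamily
  have d0 := h𝒟.nonMemberSubfamily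
  have d1 := h𝒟.memberSubfamily
  have hcompl : ∀ X ∈ 𝒞.memberSubfamily v, ∀ Y ∈ 𝒟.memberSubfamily v, Disjoint X Y →
      Y = W \ X := fun X hX Y hY hd => eq_sdiff_of_disjoint hv h𝒟 hc hshift hX hY hd
  have hcompl' : ∀ Y ∈ 𝒟.memberSubfamily v, ∀ X ∈ 𝒞.memberSubfamily v, Disjoint Y X →
      X = W \ Y := by
    intro Y hY X hX hd
    rw [hcompl X hX Y hY hd.symm, Finset.sdiff_sdiff_eq_self (b1 X hX).1]
  have c00 : Cross (𝒞.nonMemberSubfamily v) (𝒟.nonMemberSubfamily v) := fun A hA B hB =>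
    hc A (mem_nonMemberSubfamily.1 hA).1 B (mem_nonMemberSubfamily.1 hB).1
  have c01 : Cross (𝒞.nonMemberSubfamily v) (𝒟.memberSubfamily v) := by
    intro A hA B hB hd
    rw [mem_nonMemberSubfamily] at hA
    exact hc A hA.1 _ (mem_memberSubfamily.1 hB).1 (disjoint_insert_right.2 ⟨hA.2, hd⟩)
  have c10 : Cross (𝒞.memberSubfamily v) (𝒟.nonMemberSubfamily v) := by
    intro A hA B hB hd
    rw [mem_nonMemberSubfamily] at hB
    exact hc _ (mem_memberSubfamily.1 hA).1 B hB.1 (disjoint_insert_left.2 ⟨hB.2, hd⟩)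
  have n1 : ∀ X ∈ 𝒞.memberSubfamily v, W \ X ∉ 𝒟.memberSubfamily v →
      X ∈ 𝒞.nonMemberSubfamily v :=
    fun X hX => mem_nonMemberSubfamily_of_saturated h𝒞 hc sat1 hcompl hX
  have n2 : ∀ Y ∈ 𝒟.memberSubfamily v, W \ Y ∉ 𝒞.memberSubfamily v →
      Y ∈ 𝒟.nonMemberSubfamily v :=
    fun Y hY => mem_nonMemberSubfamily_of_saturated h𝒟 hc.symm sat2 hcompl' hY
  rw [← card_memberSubfamily_add_card_nonMemberSubfamily v 𝒞,
    ← card_memberSubfamily_add_card_nonMemberSubfamily v 𝒟,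
    starSize_succ_left, starSize_succ_left]
  generalize 𝒞.nonMemberSubfamily v = 𝒞₀ at *
  generalize 𝒞.memberSubfamily v = 𝒞₁ at *
  generalize 𝒟.nonMemberSubfamily v = 𝒟₀ at *
  generalize 𝒟.memberSubfamily v = 𝒟₁ at *
  let 𝒳 : Finset (Finset α) := {X ∈ 𝒞₁ | W \ X ∈ 𝒟₁}
  let compl : Finset (Finset α) → Finset (Finset α) := image (W \ ·)
  have h𝒳 : 𝒳 ⊆ 𝒞₁ := filter_subset _ _
  have hX𝒟 : ∀ S ⊆ 𝒳, compl S ⊆ 𝒟₁ := by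
    intro S hS Y hY
    obtain ⟨X, hX, rfl⟩ := mem_image.1 hY
    exact (mem_filter.1 (hS hX)).2
  have hcard : ∀ S ⊆ 𝒳, #(compl S) = #S := by
    intro S hS
    refine card_image_of_injOn fun X hX Y hY hXY => ?_
    have hX' := (b1 X (h𝒳 (hS hX))).1
    have hY' := (b1 Y (h𝒳 (hS hY))).1
    rw [← Finset.sdiff_sdiff_eq_self hX', ← Finset.sdiff_sdiff_eq_self hY']
    exact congrArg (W \ ·) hXY
  have hd0 : Disjoint 𝒞₀ 𝒳 := disjoint_left.2 fun X h0 hX =>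
    c01 X h0 _ (mem_filter.1 hX).2 disjoint_sdiff
  have hd0' : Disjoint 𝒟₀ (compl 𝒳) := disjoint_left.2 fun Y h0 hY => by
    obtain ⟨X, hX, rfl⟩ := mem_image.1 hY
    exact c10 X (h𝒳 hX) _ h0 disjoint_sdiff
  have hp : #(𝒞₁ \ 𝒳) ≤ #𝒞₀ := card_le_card fun X hX => by
    rw [mem_sdiff] at hX
    exact n1 X hX.1 fun hh => hX.2 (mem_filter.2 ⟨hX.1, hh⟩)
  have hq : #(𝒟₁ \ compl 𝒳) ≤ #𝒟₀ := card_le_card fun Y hY => by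
    rw [mem_sdiff] at hY
    have hYW := Finset.sdiff_sdiff_eq_self (d1 Y hY.1).1
    refine n2 Y hY.1 fun hh => hY.2 (mem_image.2 ⟨W \ Y, mem_filter.2 ⟨hh, ?_⟩, hYW⟩)
    rw [hYW]
    exact hY.1
  have hp' : #𝒞₁ = #(𝒞₁ \ 𝒳) + #𝒳 := (card_sdiff_add_card_eq_card h𝒳).symm
  have hq' : #𝒟₁ = #(𝒟₁ \ compl 𝒳) + #𝒳 := by
    rw [← hcard 𝒳 subset_rfl]
    exact (card_sdiff_add_card_eq_card (hX𝒟 𝒳 subset_rfl)).symm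
  rw [add_comm #𝒞₁, add_comm #𝒟₁, hp', hq']
  refine mul_le_mul_of_exchange hp hq (Nat.add_pos_left (starSize_pos hr) _)
    (Nat.add_pos_left (starSize_pos hs) _) ?_ ?_
  · intro h1 h2
    rw [starSize_of_lt (by have := lt_of_starSize_pred_eq hr h1; omega),
      starSize_of_lt (n := n) (r := s) (by have := lt_of_starSize_pred_eq hs h2; omega)]
  intro i j hij
  obtain ⟨S, hS, rfl⟩ := exists_subset_card_eq (show i ≤ #𝒳 by omega)
  have hT : 𝒳 \ S ⊆ 𝒳 := sdiff_subset
  obtain rfl : j = #(𝒳 \ S) := by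
    have := card_sdiff_add_card_eq_card hS
    omega
  have e1 : #𝒞₀ + #S = #(𝒞₀ ∪ S) := (card_union_of_disjoint (hd0.mono_right hS)).symm
  have e2 : #𝒟₀ + #(𝒳 \ S) = #(𝒟₀ ∪ compl (𝒳 \ S)) := by
    rw [card_union_of_disjoint (hd0'.mono_right (image_subset_image hT)), hcard _ hT]
  have e3 : #(𝒞₁ \ 𝒳) + #S = #(𝒞₁ \ (𝒳 \ S)) := by
    have := card_sdiff_add_card_eq_card (hT.trans h𝒳)
    omega
  have e4 : #(𝒟₁ \ compl 𝒳) + #(𝒳 \ S) = #(𝒟₁ \ compl S) := by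
    have := card_sdiff_add_card_eq_card (hX𝒟 S hS)
    rw [hcard S hS] at this
    omega
  have c11 : Cross (𝒞₁ \ (𝒳 \ S)) (𝒟₁ \ compl S) := by
    intro X hX Y hY hd
    rw [mem_sdiff] at hX hY
    obtain rfl := hcompl X hX.1 Y hY.1 hd
    refine hX.2 (mem_sdiff.2 ⟨mem_filter.2 ⟨hX.1, hY.1⟩, fun hXS => hY.2 ?_⟩)
    exact mem_image_of_mem _ hXS
  have cS1 : Cross S (𝒟₁ \ compl S) := fun X hX => c11 X
    (mem_sdiff.2 ⟨h𝒳 (hS hX), fun hh => (mem_sdiff.1 hh).2 hX⟩)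
  have hinj : ∀ X ∈ 𝒳 \ S, W \ X ∉ compl S := by
    intro X hX hh
    obtain ⟨X', hX', he⟩ := mem_image.1 hh
    rw [mem_sdiff] at hX
    have h1 := (b1 X (h𝒳 hX.1)).1
    have h2 := (b1 X' (h𝒳 (hS hX'))).1
    apply hX.2
    rw [← Finset.sdiff_sdiff_eq_self h1, ← he, Finset.sdiff_sdiff_eq_self h2]
    exact hX'
  have hsub : compl (𝒳 \ S) ⊆ 𝒟₁ \ compl S := by
    intro Y hY
    refine mem_sdiff.2 ⟨hX𝒟 _ hT hY, ?_⟩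
    obtain ⟨X, hX, rfl⟩ := mem_image.1 hY
    exact hinj X hX
  have bU : BoundedIn W r (𝒞₀ ∪ S) := b0.union (b1.mono (Nat.sub_le _ _) (hS.trans h𝒳))
  have dU : BoundedIn W s (𝒟₀ ∪ compl (𝒳 \ S)) :=
    d0.union (d1.mono (Nat.sub_le _ _) (hX𝒟 _ hT))
  have bD : BoundedIn W (r - 1) (𝒞₁ \ (𝒳 \ S)) := b1.mono le_rfl sdiff_subset
  have dD : BoundedIn W (s - 1) (𝒟₁ \ compl S) := d1.mono le_rfl sdiff_subset
  rw [e1, e2, e3, e4]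
  refine ⟨ih hW bU dU ?_, ih hW bU dD ?_, ih hW bD dU ?_, ih hW bD dD c11⟩
  · intro X hX Y hY
    rcases mem_union.1 hX with hX | hX <;> rcases mem_union.1 hY with hY | hY
    · exact c00 X hX Y hY
    · exact c01 X hX Y (hX𝒟 _ hT hY)
    · exact c10 X (h𝒳 (hS hX)) Y hY
    · exact cS1 X hX Y (hsub hY)
  · intro X hX Y hY
    rcases mem_union.1 hX with hX | hX
    · exact c01 X hX Y (mem_sdiff.1 hY).1
    · exact cS1 X hX Y hY
  · intro X hX Y hY
    rcases mem_union.1 hY with hY | hY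
    · exact c10 X (mem_sdiff.1 hX).1 Y hY
    · exact c11 X hX Y (hsub hY)

/-- The product bound for two cross-intersecting families on nested ground sets. -/
theorem card_mul_card_le_of_subset {U V : Finset α} {m n : ℕ} (hUV : U ⊆ V) (hU : #U = m + 1)
    (hV : #V = n + 1) {r s : ℕ} {𝒜 ℬ : Finset (Finset α)} (h𝒜 : BoundedIn U r 𝒜)
    (hℬ : BoundedIn V s ℬ) (h : Cross 𝒜 ℬ) : #𝒜 * #ℬ ≤ starSize m r * starSize n s := by
  induction n generalizing V s ℬ with
  | zero =>
    obtain rfl : U = V := eq_of_subset_of_card_le hUV (by omega)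
    obtain rfl : m = 0 := by omega
    exact card_mul_card_le hU h𝒜 hℬ h
  | succ n ih =>
    rcases hUV.eq_or_ssubset with rfl | hss
    · obtain rfl : m = n + 1 := by omega
      exact card_mul_card_le hU h𝒜 hℬ h
    obtain ⟨v, hvV, hvU⟩ := exists_of_ssubset hss
    have hUW : U ⊆ V.erase v := fun x hx => mem_erase.2 ⟨fun e => hvU (e ▸ hx), hUV hx⟩
    have hW : #(V.erase v) = n + 1 := by rw [card_erase_of_mem hvV]; omega
    rw [← insert_erase hvV] at hℬ
    have h0 := ih hUW hW hℬ.nonMemberSubfamily fun A hA B hB =>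
      h A hA B (mem_nonMemberSubfamily.1 hB).1
    have h1 := ih hUW hW hℬ.memberSubfamily fun A hA B hB hd =>
      h A hA _ (mem_memberSubfamily.1 hB).1
        (disjoint_insert_right.2 ⟨fun hvA => hvU ((h𝒜 A hA).1 hvA), hd⟩)
    rw [← card_memberSubfamily_add_card_nonMemberSubfamily v ℬ, starSize_succ_left]
    linarith

/-- If all pairwise products are bounded, so is the total product. -/
theorem prod_le_prod_of_pairwise {k : ℕ} (hk : 2 ≤ k) {a b : Fin k → ℕ}
    (h : ∀ i j, i ≠ j → a i * a j ≤ b i * b j) : ∏ i, a i ≤ ∏ i, b i := by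
  have key : ∀ c : Fin k → ℕ, ∏ i, ∏ j ∈ univ.erase i, c i * c j = (∏ i, c i) ^ (2 * (k - 1)) := by
    intro c
    have hswap : ∏ i, ∏ j ∈ univ.erase i, c j = ∏ j, ∏ i ∈ univ.erase j, c j :=
      prod_comm' (by simp [eq_comm])
    simp only [prod_mul_distrib]
    rw [hswap]
    simp only [prod_const, card_erase_of_mem (mem_univ _), card_univ, Fintype.card_fin, prod_pow]
    rw [two_mul, pow_add]
  refine (Nat.pow_le_pow_iff_left (n := 2 * (k - 1)) (by omega)).1 ?_
  rw [← key, ← key]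
  exact prod_le_prod' fun i _ => prod_le_prod' fun j hj => h i j (ne_of_mem_erase hj).symm

end CrossIntersecting

/-- The product bound for `k ≥ 2` cross-intersecting families
`A_i ⊆ {subsets of [n_i] of size ≤ r_i}`. -/
theorem cross_intersecting_k_families_product_bound
    (k : ℕ) (hk : 2 ≤ k) (n r : Fin k → ℕ)
    (hr1 : ∀ i, 1 ≤ r i) (hrn : ∀ i, r i ≤ n i)
    (𝒜 : Fin k → Finset (Finset ℕ))
    (h𝒜 : ∀ i, ∀ A ∈ 𝒜 i, A ⊆ Finset.Icc 1 (n i) ∧ A.card ≤ r i)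
    (hcross : ∀ i j, i ≠ j → ∀ A ∈ 𝒜 i, ∀ B ∈ 𝒜 j, (A ∩ B).Nonempty) :
    ∏ i, (𝒜 i).card ≤
      ∏ i, ∑ j ∈ Finset.Icc 1 (r i), Nat.choose (n i - 1) (j - 1) := by
  have hcard : ∀ i, #(Icc 1 (n i)) = n i - 1 + 1 := fun i => by
    have := hr1 i
    have := hrn i
    rw [Nat.card_Icc]
    omega
  have hstar : ∀ i, ∑ j ∈ Icc 1 (r i), Nat.choose (n i - 1) (j - 1) =
      CrossIntersecting.starSize (n i - 1) (r i) := fun i => by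
    rw [CrossIntersecting.starSize, range_eq_Ico,
      ← sum_Ico_add_right_sub_eq (f := fun j => (n i - 1).choose j) 0 (r i) 1]
    rfl
  refine CrossIntersecting.prod_le_prod_of_pairwise hk fun i j hij => ?_
  rw [hstar, hstar]
  have hdisj : ∀ i j, i ≠ j → CrossIntersecting.Cross (𝒜 i) (𝒜 j) :=
    fun i j hij A hA B hB => not_disjoint_iff_nonempty_inter.2 (hcross i j hij A hA B hB)
  rcases le_total (n i) (n j) with hle | hle
  · exact CrossIntersecting.card_mul_card_le_of_subset (Icc_subset_Icc_right hle) (hcard i)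
      (hcard j) (h𝒜 i) (h𝒜 j) (hdisj i j hij)
  · rw [mul_comm, mul_comm (CrossIntersecting.starSize _ _)]
    exact CrossIntersecting.card_mul_card_le_of_subset (Icc_subset_Icc_right hle) (hcard j)
      (hcard i) (h𝒜 j) (h𝒜 i) (hdisj j i hij.symm)
end
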